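/- Let b ≥ 2, n ≥ 1 and Σ ∈ {id,τ}^n, where id is the identity permutation of {0,…,b−1} and τ(k) = b−1−k. Then (2b^n · L2(R_{b,n}^{Σ,sym}))^2 = n·(b^2/360 + 1/24 − 2/(45b^2)) + 11/8 + 1/b^n + (1 − 9·(−1)^b)/(144·b^{2n}). -/

import Mathlib

open Finset
open scoped Classical

noncomputable section

namespace SymHamm

/-- The reversal permutation `τ(k) = b−1−k` on `{0,…,b−1}`. -/
def tauP (b : ℕ) : Equiv.Perm (Fin b) := Fin.revPerm

/-- `σ̄ = τ ∘ σ`. -/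
def pbar {b : ℕ} (σ : Equiv.Perm (Fin b)) : Equiv.Perm (Fin b) := σ.trans (tauP b)

/-- Value of a permutation of `Fin b` on a natural number. -/
def permVal {b : ℕ} (σ : Equiv.Perm (Fin b)) (k : ℕ) : ℕ :=
  if h : k < b then (σ ⟨k, h⟩ : ℕ) else 0

/-- Faure's function `φ_{b,h}^σ`, extended with period 1 to all of `ℝ`.
For `x ∈ [(k−1)/b, k/b)` (i.e. `k−1 = ⌊b·{x}⌋`), it equals
`A([0,h/b);k;Z_b^σ) − h·x` if `h ≤ σ(k−1)` and `(b−h)·x − A([h/b,1);k;Z_b^σ)` otherwise,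
where `A` counts the first `k` entries `σ(0)/b,…,σ(k−1)/b` of `Z_b^σ` in the interval. -/
def phi {b : ℕ} (σ : Equiv.Perm (Fin b)) (h : ℕ) (x : ℝ) : ℝ :=
  if h ≤ permVal σ (⌊(b : ℝ) * Int.fract x⌋).toNat then
    (((Finset.range ((⌊(b : ℝ) * Int.fract x⌋).toNat + 1)).filter
        (fun l => permVal σ l < h)).card : ℝ) - (h : ℝ) * Int.fract x
  else
    ((b : ℝ) - (h : ℝ)) * Int.fract x -
      (((Finset.range ((⌊(b : ℝ) * Int.fract x⌋).toNat + 1)).filter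
        (fun l => h ≤ permVal σ l)).card : ℝ)

/-- `φ_b^σ = ∑_{h=0}^{b−1} φ_{b,h}^σ`. -/
def phiS {b : ℕ} (σ : Equiv.Perm (Fin b)) (x : ℝ) : ℝ := ∑ h ∈ range b, phi σ h x

/-- `φ_b^{σ,(2)} = ∑_{h=0}^{b−1} (φ_{b,h}^σ)²`. -/
def phiS2 {b : ℕ} (σ : Equiv.Perm (Fin b)) (x : ℝ) : ℝ := ∑ h ∈ range b, (phi σ h x) ^ 2

/-- `φ̃_b^σ = ∑_{h=0}^{b−1} φ_{b,h}^σ · φ_{b,h}^{σ̄}`. -/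
def phiT {b : ℕ} (σ : Equiv.Perm (Fin b)) (x : ℝ) : ℝ :=
  ∑ h ∈ range b, phi σ h x * phi (pbar σ) h x

/-- `φ̃_{b,1}^σ = ∑_{h=0}^{b−2} φ_{b,h+1}^σ · φ_{b,h}^{σ̄}`. -/
def phiT1 {b : ℕ} (σ : Equiv.Perm (Fin b)) (x : ℝ) : ℝ :=
  ∑ h ∈ range (b - 1), phi σ (h + 1) x * phi (pbar σ) h x

/-- `φ̃_{b,2}^σ = ∑_{h=0}^{b−2} φ_{b,h}^σ · φ_{b,h+1}^{σ̄}`. -/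
def phiT2 {b : ℕ} (σ : Equiv.Perm (Fin b)) (x : ℝ) : ℝ :=
  ∑ h ∈ range (b - 1), phi σ h x * phi (pbar σ) (h + 1) x

/-- `Φ_b^σ = (1/b)·∫_0^1 φ_b^σ`. -/
def PhiS {b : ℕ} (σ : Equiv.Perm (Fin b)) : ℝ := (1 / (b : ℝ)) * ∫ x in (0:ℝ)..1, phiS σ x

/-- `Φ_b^{σ,(2)} = (1/b)·∫_0^1 φ_b^{σ,(2)}`. -/
def PhiS2 {b : ℕ} (σ : Equiv.Perm (Fin b)) : ℝ := (1 / (b : ℝ)) * ∫ x in (0:ℝ)..1, phiS2 σ x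

/-- `Φ̃_b^σ = (1/b)·∫_0^1 φ̃_b^σ`. -/
def PhiT {b : ℕ} (σ : Equiv.Perm (Fin b)) : ℝ := (1 / (b : ℝ)) * ∫ x in (0:ℝ)..1, phiT σ x

/-- `Φ̃_{b,1}^σ = (1/b)·∫_0^1 φ̃_{b,1}^σ`. -/
def PhiT1 {b : ℕ} (σ : Equiv.Perm (Fin b)) : ℝ := (1 / (b : ℝ)) * ∫ x in (0:ℝ)..1, phiT1 σ x

/-- `Φ̃_{b,2}^σ = (1/b)·∫_0^1 φ̃_{b,2}^σ`. -/
def PhiT2 {b : ℕ} (σ : Equiv.Perm (Fin b)) : ℝ := (1 / (b : ℝ)) * ∫ x in (0:ℝ)..1, phiT2 σ x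

/-- `ν_j(N,Σ) = σ_j(N_j)·b^{n−j−1} + … + σ_{n−1}(N_{n−1})`, where `N_i` is the `i`-th
`b`-adic digit of `N`. -/
def nu (b n : ℕ) (S : Fin n → Equiv.Perm (Fin b)) (N j : ℕ) : ℕ :=
  ∑ i : Fin n,
    if j ≤ (i : ℕ) then permVal (S i) ((N / b ^ (i : ℕ)) % b) * b ^ (n - 1 - (i : ℕ)) else 0

/-- `ε_j(λ,N,Σ)`, for `1 ≤ j ≤ n`: it is `0` when `λ = bⁿ` or `N = bⁿ`; it is the last digit
`λ_n = λ % b` when `j = n`; otherwise, with `Λ_{j−1} = λ % b^{n−j+1}` and `ν_j = ν_j(N,Σ)`,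
it is `0` if `Λ_{j−1} ≤ ν_j`, it is `h` if `ν_j + (h−1)b^{n−j} < Λ_{j−1} ≤ ν_j + h·b^{n−j}`
for some `1 ≤ h < b`, and `0` if `ν_j + (b−1)b^{n−j} < Λ_{j−1} < b^{n−j+1}`. -/
def eps (b n : ℕ) (S : Fin n → Equiv.Perm (Fin b)) (lam N j : ℕ) : ℕ :=
  if lam = b ^ n ∨ N = b ^ n then 0
  else if j = n then lam % b
  else if lam % b ^ (n - j + 1) ≤ nu b n S N j then 0
  else ((lam % b ^ (n - j + 1) - nu b n S N j - 1) / b ^ (n - j) + 1) % b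

/-- The point of the digit-scrambled Hammersley point set `R_{b,n}^Σ` with digits `a`:
`(∑_{j=0}^{n−1} σ_j(a_j)/b^{n−j}, ∑_{j=0}^{n−1} a_j/b^{j+1})`. -/
def hammPt (b n : ℕ) (S : Fin n → Equiv.Perm (Fin b)) (a : Fin n → Fin b) : ℝ × ℝ :=
  (∑ j : Fin n, ((S j (a j) : ℕ) : ℝ) / (b : ℝ) ^ (n - (j : ℕ)),
   ∑ j : Fin n, ((a j : ℕ) : ℝ) / (b : ℝ) ^ ((j : ℕ) + 1))

/-- The symmetrized Hammersley point set `R_{b,n}^{Σ,sym} = R_{b,n}^Σ ∪ R_{b,n}^{Σ*}`,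
a family of `2·bⁿ` points. -/
def symFam (b n : ℕ) (S : Fin n → Equiv.Perm (Fin b)) :
    Bool × (Fin n → Fin b) → ℝ × ℝ :=
  fun p => if p.1 then hammPt b n S p.2 else hammPt b n (fun i => pbar (S i)) p.2

/-- Local discrepancy `E(x,y,P) = #{i : P i ∈ [0,x)×[0,y)} − N·x·y` of a finite family of
points, where `N` is the number of points. -/
def localDisc {ι : Type} [Fintype ι] (P : ι → ℝ × ℝ) (x y : ℝ) : ℝ :=
  ((Finset.univ.filter
      (fun i => 0 ≤ (P i).1 ∧ (P i).1 < x ∧ 0 ≤ (P i).2 ∧ (P i).2 < y)).card : ℝ)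
    - (Fintype.card ι : ℝ) * x * y

/-- `L_2` discrepancy `L2(P) = (1/N)·(∫_0^1∫_0^1 E(x,y,P)² dx dy)^{1/2}`. -/
def L2disc {ι : Type} [Fintype ι] (P : ι → ℝ × ℝ) : ℝ :=
  (1 / (Fintype.card ι : ℝ)) *
    Real.sqrt (∫ x in (0:ℝ)..1, ∫ y in (0:ℝ)..1, (localDisc P x y) ^ 2)


theorem sum_sign_range {k N : ℕ} (h : k + 1 ≤ N) :
    ∑ l ∈ range N, ((k : ℤ) - l).sign = 2 * k - ((N : ℤ) - 1) := by
  induction N, h using Nat.le_induction with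
  | base =>
    rw [sum_range_succ, sum_congr rfl (g := fun _ => (1 : ℤ))]
    · simp
      ring
    · intro l hl
      rw [mem_range] at hl
      exact Int.sign_eq_one_of_pos (by omega)
  | succ M hM ih =>
    rw [sum_range_succ, ih, Int.sign_eq_neg_one_of_neg (by omega)]
    push_cast
    ring

theorem sum_range_centred_add_two (f : ℤ → ℤ) (m : ℕ) :
    ∑ k ∈ range (m + 2), f (2 * (k : ℤ) - (((m + 2 : ℕ) : ℤ) - 1)) =
      f (-((m : ℤ) + 1)) + f ((m : ℤ) + 1) + ∑ k ∈ range m, f (2 * (k : ℤ) - ((m : ℤ) - 1)) := by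
  rw [sum_range_succ, sum_range_succ']
  have h1 : (2 * ((0 : ℕ) : ℤ) - (((m + 2 : ℕ) : ℤ) - 1)) = -((m : ℤ) + 1) := by push_cast; ring
  have h2 : (2 * ((m + 1 : ℕ) : ℤ) - (((m + 2 : ℕ) : ℤ) - 1)) = (m : ℤ) + 1 := by push_cast; ring
  have h3 : ∀ k : ℕ, (2 * ((k + 1 : ℕ) : ℤ) - (((m + 2 : ℕ) : ℤ) - 1)) =
      2 * (k : ℤ) - ((m : ℤ) - 1) := by intro k; push_cast; ring
  simp only [h1, h2, h3]
  ring

/-- `u` enumerates bijectively the centred grid `{-(N-1), -(N-3), …, N-1}`. -/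
def IsGrid {ι : Type} (N : ℕ) (u : ι → ℤ) : Prop :=
  ∃ e : ι ≃ Fin N, ∀ p, u p = 2 * ((e p : ℕ) : ℤ) - ((N : ℤ) - 1)

namespace IsGrid

variable {ι κ : Type} {N m : ℕ} {u : ι → ℤ}

theorem fin (N : ℕ) : IsGrid N (fun k : Fin N => 2 * ((k : ℕ) : ℤ) - ((N : ℤ) - 1)) :=
  ⟨Equiv.refl _, fun _ => rfl⟩

theorem comp_equiv (hu : IsGrid N u) (e : κ ≃ ι) : IsGrid N (fun k => u (e k)) := by
  obtain ⟨f, hf⟩ := hu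
  exact ⟨e.trans f, fun p => hf _⟩

theorem of_comp_equiv (e : κ ≃ ι) (h : IsGrid N (fun k => u (e k))) : IsGrid N u := by
  simpa using h.comp_equiv e.symm

theorem neg (hu : IsGrid N u) : IsGrid N (fun p => -u p) := by
  obtain ⟨e, he⟩ := hu
  refine ⟨e.trans Fin.revPerm, fun p => ?_⟩
  have h := (e p).isLt
  simp only [Equiv.trans_apply, Fin.revPerm_apply, Fin.val_rev, he]
  omega

theorem prod {w : κ → ℤ} (hw : IsGrid m w) (hu : IsGrid N u) :
    IsGrid (m * N) (fun x : κ × ι => (N : ℤ) * w x.1 + u x.2) := by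
  obtain ⟨e, he⟩ := hw
  obtain ⟨f, hf⟩ := hu
  refine ⟨(e.prodCongr f).trans finProdFinEquiv, fun x => ?_⟩
  simp only [he, hf, Equiv.trans_apply, Equiv.prodCongr_apply, Prod.map, finProdFinEquiv_apply_val]
  push_cast
  ring

theorem eq_of_eq (hu : IsGrid N u) {p q : ι} (h : u p = u q) : p = q := by
  obtain ⟨e, he⟩ := hu
  rw [he, he] at h
  apply e.injective
  apply Fin.ext
  omega

theorem abs_sub_lt (hu : IsGrid N u) (p q : ι) : |u p - u q| < 2 * N := by
  obtain ⟨e, he⟩ := hu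
  have h1 := (e p).isLt
  have h2 := (e q).isLt
  rw [he, he, abs_lt]
  omega

theorem abs_add_lt (hu : IsGrid N u) (p q : ι) : |u p + u q| < 2 * N := by
  obtain ⟨e, he⟩ := hu
  have h1 := (e p).isLt
  have h2 := (e q).isLt
  rw [he, he, abs_lt]
  omega

theorem two_le_abs_sub (hu : IsGrid N u) (p q : ι) : u p - u q = 0 ∨ 2 ≤ |u p - u q| := by
  obtain ⟨e, he⟩ := hu
  rw [he, he, le_abs]
  omega

theorem two_le_abs_add (hu : IsGrid N u) (p q : ι) : u p + u q = 0 ∨ 2 ≤ |u p + u q| := by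
  obtain ⟨e, he⟩ := hu
  rw [he, he, le_abs]
  omega

variable [Fintype ι]

theorem card_eq (hu : IsGrid N u) : Fintype.card ι = N := by
  obtain ⟨e, -⟩ := hu
  simpa using Fintype.card_congr e

theorem sum_eq (hu : IsGrid N u) (f : ℤ → ℤ) :
    ∑ p, f (u p) = ∑ k ∈ range N, f (2 * (k : ℤ) - ((N : ℤ) - 1)) := by
  obtain ⟨e, he⟩ := hu
  rw [← Fin.sum_univ_eq_sum_range (fun k : ℕ => f (2 * (k : ℤ) - ((N : ℤ) - 1))),
    ← Equiv.sum_comp e]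
  simp only [he]

theorem sum_neg (hu : IsGrid N u) (f : ℤ → ℤ) : ∑ p, f (-u p) = ∑ p, f (u p) := by
  rw [hu.sum_eq f, hu.neg.sum_eq f]

theorem sum_odd (hu : IsGrid N u) (f : ℤ → ℤ) (hf : ∀ x, f (-x) = -f x) : ∑ p, f (u p) = 0 := by
  have h := hu.sum_neg f
  simp only [hf, sum_neg_distrib] at h
  omega

theorem sum_self (hu : IsGrid N u) : ∑ p, u p = 0 := hu.sum_odd (fun x => x) (fun _ => rfl)

theorem sum_sq (hu : IsGrid N u) : 3 * ∑ p, u p ^ 2 = (N : ℤ) * ((N : ℤ) ^ 2 - 1) := by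
  have key : ∀ (t : ℤ) (n : ℕ), 3 * ∑ k ∈ range n, (2 * (k : ℤ) - t) ^ 2 =
      2 * n * (n - 1) * (2 * n - 1) - 6 * t * n * (n - 1) + 3 * n * t ^ 2 := by
    intro t n
    induction n with
    | zero => simp
    | succ n ih => rw [sum_range_succ, mul_add, ih]; push_cast; ring
  rw [hu.sum_eq (fun x => x ^ 2), key]
  ring

theorem sum_pow_four (hu : IsGrid N u) :
    15 * ∑ p, u p ^ 4 = (N : ℤ) * ((N : ℤ) ^ 2 - 1) * (3 * (N : ℤ) ^ 2 - 7) := by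
  have key : ∀ (t : ℤ) (n : ℕ), 15 * ∑ k ∈ range n, (2 * (k : ℤ) - t) ^ 4 =
      8 * n * (n - 1) * (2 * n - 1) * (3 * n ^ 2 - 3 * n - 1) - 120 * t * n ^ 2 * (n - 1) ^ 2
        + 60 * t ^ 2 * n * (n - 1) * (2 * n - 1) - 60 * t ^ 3 * n * (n - 1) + 15 * n * t ^ 4 := by
    intro t n
    induction n with
    | zero => simp
    | succ n ih => rw [sum_range_succ, mul_add, ih]; push_cast; ring
  rw [hu.sum_eq (fun x => x ^ 4), key]
  ring

theorem sum_sign (hu : IsGrid N u) (p : ι) : ∑ q, (u p - u q).sign = u p := by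
  rw [hu.sum_eq (fun x => (u p - x).sign)]
  obtain ⟨e, he⟩ := hu
  have h1 := (e p).isLt
  rw [he]
  generalize ((e p : Fin N) : ℕ) = k at h1
  have h2 : ∀ l : ℕ, (2 * (k : ℤ) - ((N : ℤ) - 1) - (2 * (l : ℤ) - ((N : ℤ) - 1))).sign
      = ((k : ℤ) - l).sign := by
    intro l
    rw [show 2 * (k : ℤ) - ((N : ℤ) - 1) - (2 * (l : ℤ) - ((N : ℤ) - 1)) = 2 * ((k : ℤ) - l) by ring,
      Int.sign_mul, Int.sign_eq_one_of_pos two_pos, one_mul]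
  simp only [h2]
  exact sum_sign_range h1

theorem sum_abs (hu : IsGrid N u) : 2 * ∑ p, |u p| = (N : ℤ) ^ 2 - (N % 2 : ℕ) := by
  rw [hu.sum_eq (fun x => |x|)]
  clear hu
  induction N using Nat.twoStepInduction with
  | zero => simp
  | one => simp
  | more m ih _ =>
    rw [sum_range_centred_add_two (fun x => |x|), mul_add, ih, abs_neg,
      abs_of_nonneg (by positivity : (0 : ℤ) ≤ (m : ℤ) + 1), Nat.add_mod_right]
    push_cast
    ring

theorem sum_abs_sq_sub_sq (hu : IsGrid N u) :
    3 * ∑ p, ∑ q, |u p ^ 2 - u q ^ 2| = (N : ℤ) ^ 2 * ((N : ℤ) ^ 2 - 4) + 3 * (N % 2 : ℕ) := by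
  have h : ∀ p, ∑ q, |u p ^ 2 - u q ^ 2| =
      ∑ k ∈ range N, |u p ^ 2 - (2 * (k : ℤ) - ((N : ℤ) - 1)) ^ 2| :=
    fun p => hu.sum_eq (fun x => |u p ^ 2 - x ^ 2|)
  simp only [h]
  rw [hu.sum_eq (fun y => ∑ k ∈ range N, |y ^ 2 - (2 * (k : ℤ) - ((N : ℤ) - 1)) ^ 2|)]
  clear hu h
  induction N using Nat.twoStepInduction with
  | zero => simp
  | one => simp
  | more m ih _ =>
    have hm : ∀ y, ∑ k ∈ range (m + 2), |y ^ 2 - (2 * (k : ℤ) - (((m + 2 : ℕ) : ℤ) - 1)) ^ 2| =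
        _ := fun y => sum_range_centred_add_two (fun x => |y ^ 2 - x ^ 2|) m
    have hedge : 3 * ∑ k ∈ range m, |((m : ℤ) + 1) ^ 2 - (2 * (k : ℤ) - ((m : ℤ) - 1)) ^ 2| =
        3 * m * ((m : ℤ) + 1) ^ 2 - m * ((m : ℤ) ^ 2 - 1) := by
      have hs := (IsGrid.fin m).sum_sq
      rw [(IsGrid.fin m).sum_eq (fun x => x ^ 2)] at hs
      rw [← hs, sum_congr rfl (g := fun k : ℕ => ((m : ℤ) + 1) ^ 2 -
        (2 * (k : ℤ) - ((m : ℤ) - 1)) ^ 2)]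
      · rw [sum_sub_distrib, sum_const, card_range, nsmul_eq_mul]
        ring
      · intro k hk
        rw [mem_range] at hk
        apply abs_of_nonneg
        nlinarith
    have hedge' : ∑ k ∈ range m, |(2 * (k : ℤ) - ((m : ℤ) - 1)) ^ 2 - ((m : ℤ) + 1) ^ 2| =
        ∑ k ∈ range m, |((m : ℤ) + 1) ^ 2 - (2 * (k : ℤ) - ((m : ℤ) - 1)) ^ 2| :=
      sum_congr rfl fun k _ => abs_sub_comm _ _
    simp only [hm]
    rw [sum_range_centred_add_two (fun y => |y ^ 2 - (-((m : ℤ) + 1)) ^ 2| +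
      |y ^ 2 - ((m : ℤ) + 1) ^ 2| +
        ∑ k ∈ range m, |y ^ 2 - (2 * (k : ℤ) - ((m : ℤ) - 1)) ^ 2|)]
    simp only [sum_add_distrib, neg_sq, sub_self, abs_zero, hedge', Nat.add_mod_right]
    push_cast at ih ⊢
    linear_combination ih + 4 * hedge

theorem sum_sub_sq (hu : IsGrid N u) : ∑ p, ∑ q, (u p - u q) ^ 2 = 2 * N * ∑ p, u p ^ 2 := by
  have h : ∀ p q, (u p - u q) ^ 2 = u p ^ 2 + u q ^ 2 - 2 * (u p * u q) := by intros; ring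
  simp only [h, sum_sub_distrib, sum_add_distrib, sum_const, card_univ, hu.card_eq, nsmul_eq_mul,
    ← mul_sum, hu.sum_self, mul_zero]
  ring

theorem sum_sum_neg_right (hu : IsGrid N u) (f : ℤ → ℤ → ℤ) :
    ∑ p, ∑ q, f (u p) (-u q) = ∑ p, ∑ q, f (u p) (u q) :=
  sum_congr rfl fun p _ => hu.sum_neg (f (u p))

theorem sum_sign_mul_sub (hu : IsGrid N u) (v : ι → ℤ) :
    ∑ p, ∑ q, (u p - u q).sign * (v p - v q) = 2 * ∑ p, u p * v p := by
  have h1 : ∑ p, ∑ q, (u p - u q).sign * v p = ∑ p, u p * v p :=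
    sum_congr rfl fun p _ => by rw [← sum_mul, hu.sum_sign]
  have h2 : ∑ p, ∑ q, (u p - u q).sign * v q = -∑ p, u p * v p := by
    rw [sum_comm, ← h1, ← sum_neg_distrib]
    refine sum_congr rfl fun p _ => ?_
    rw [← sum_neg_distrib]
    refine sum_congr rfl fun q _ => ?_
    rw [← neg_sub, Int.sign_neg]
    ring
  simp only [mul_sub, sum_sub_distrib, h1, h2]
  ring

theorem sum_abs_sub (hu : IsGrid N u) : ∑ p, ∑ q, |u p - u q| = 2 * ∑ p, u p ^ 2 := by
  simp only [sq, ← hu.sum_sign_mul_sub u, Int.sign_mul_self_eq_abs]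

theorem sum_abs_add (hu : IsGrid N u) : ∑ p, ∑ q, |u p + u q| = 2 * ∑ p, u p ^ 2 := by
  rw [← hu.sum_abs_sub, ← hu.sum_sum_neg_right (fun x y => |x - y|)]
  simp only [sub_neg_eq_add]

theorem sum_ite_sub_eq_zero (hu : IsGrid N u) (g : ι → ι → ℤ) :
    ∑ p, ∑ q, (if u p - u q = 0 then g p q else 0) = ∑ p, g p p := by
  refine sum_congr rfl fun p _ => ?_
  rw [sum_eq_single p]
  · simp
  · intro q _ hq
    rw [if_neg]
    intro h
    exact hq (hu.eq_of_eq (sub_eq_zero.1 h)).symm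
  · simp

theorem sum_ite_add_eq_zero (hu : IsGrid N u) (f : ℤ → ℤ → ℤ) :
    ∑ p, ∑ q, (if u p + u q = 0 then f (u p) (u q) else 0) = ∑ p, f (u p) (-u p) := by
  rw [← hu.sum_sum_neg_right (fun x y => if x + y = 0 then f x y else 0)]
  simp only [← sub_eq_add_neg]
  exact hu.sum_ite_sub_eq_zero (fun p q => f (u p) (-u q))

end IsGrid

/-- `∑_{p,q} |u_p - u_q| |v_p - v_q|`. -/
def diffSum {ι : Type} [Fintype ι] (u v : ι → ℤ) : ℤ := ∑ p, ∑ q, |u p - u q| * |v p - v q|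

/-- `∑_{p,q} |u_p - u_q| |v_p + v_q|`. -/
def crossSum {ι : Type} [Fintype ι] (u v : ι → ℤ) : ℤ := ∑ p, ∑ q, |u p - u q| * |v p + v q|

theorem abs_mul_add_eq {m d e : ℤ} (hd : d = 0 ∨ 2 ≤ |d|) (he : |e| < 2 * m) :
    |m * d + e| = m * |d| + d.sign * e + if d = 0 then |e| else 0 := by
  obtain ⟨he1, he2⟩ := abs_lt.1 he
  rcases lt_trichotomy d 0 with h | h | h
  · rw [abs_of_neg h] at hd
    rw [if_neg h.ne, abs_of_neg h, Int.sign_eq_neg_one_of_neg h, abs_of_nonpos]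
    · ring
    · nlinarith [hd.resolve_left h.ne]
  · simp [h]
  · rw [abs_of_pos h] at hd
    rw [if_neg h.ne', abs_of_pos h, Int.sign_eq_one_of_pos h, abs_of_nonneg]
    · ring
    · nlinarith [hd.resolve_left h.ne']

theorem sum_sum_prod_mul {ι κ : Type} [Fintype ι] [Fintype κ] (f : κ → κ → ℤ) (g : ι → ι → ℤ) :
    ∑ x : κ × ι, ∑ y : κ × ι, f x.1 y.1 * g x.2 y.2 =
      (∑ a, ∑ c, f a c) * ∑ p, ∑ q, g p q := by
  simp only [Fintype.sum_prod_type, ← mul_sum, ← sum_mul]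

theorem sum_sum_antisymm {ι : Type} [Fintype ι] (f : ι → ι → ℤ) (hf : ∀ p q, f q p = -f p q) :
    ∑ p, ∑ q, f p q = 0 := by
  have h : ∑ p, ∑ q, f q p = -∑ p, ∑ q, f p q := by
    rw [← sum_neg_distrib]
    refine sum_congr rfl fun p _ => ?_
    rw [← sum_neg_distrib]
    exact sum_congr rfl fun q _ => hf p q
  have hcomm : ∑ p, ∑ q, f p q = ∑ p, ∑ q, f q p := sum_comm
  omega

theorem sign_sub_comm (x y : ℤ) : (y - x).sign = -(x - y).sign := by
  rw [← neg_sub, Int.sign_neg]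

section Step

variable {ι κ : Type} [Fintype ι] [Fintype κ] {N b : ℕ} {u v : ι → ℤ} {w : κ → ℤ} {s : ℤ}

theorem diffSum_step (hu : IsGrid N u) (hv : IsGrid N v) (hw : IsGrid b w) (hs : s = 1 ∨ s = -1) :
    diffSum (fun x : κ × ι => (b : ℤ) * u x.2 + s * w x.1)
        (fun x : κ × ι => (N : ℤ) * w x.1 + v x.2) =
      (b : ℤ) ^ 2 * diffSum u v + 4 * b * N * (∑ a, w a ^ 2) * (∑ p, u p ^ 2)
        + 4 * s * (∑ a, w a ^ 2) * (∑ p, u p * v p) + 2 * b * (N : ℤ) ^ 2 * ∑ a, w a ^ 2 := by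
  have habs : |s| = 1 := by rcases hs with rfl | rfl <;> rfl
  have key : ∀ x y : κ × ι,
      |((b : ℤ) * u x.2 + s * w x.1) - (b * u y.2 + s * w y.1)| *
        |((N : ℤ) * w x.1 + v x.2) - (N * w y.1 + v y.2)| =
      b * N * (|w x.1 - w y.1| * |u x.2 - u y.2|)
      + b * ((w x.1 - w y.1).sign * (|u x.2 - u y.2| * (v x.2 - v y.2)))
      + b * ((if w x.1 - w y.1 = 0 then 1 else 0) * (|u x.2 - u y.2| * |v x.2 - v y.2|))
      + N * s * (((w x.1 - w y.1) * |w x.1 - w y.1|) * (u x.2 - u y.2).sign)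
      + s * (|w x.1 - w y.1| * ((u x.2 - u y.2).sign * (v x.2 - v y.2)))
      + N * ((w x.1 - w y.1) ^ 2 * (if u x.2 - u y.2 = 0 then 1 else 0)) := by
    intro x y
    rw [show ((b : ℤ) * u x.2 + s * w x.1) - (b * u y.2 + s * w y.1) =
        b * (u x.2 - u y.2) + s * (w x.1 - w y.1) by ring,
      show ((N : ℤ) * w x.1 + v x.2) - (N * w y.1 + v y.2) =
        N * (w x.1 - w y.1) + (v x.2 - v y.2) by ring,
      abs_mul_add_eq (hu.two_le_abs_sub _ _) (by rw [abs_mul, habs, one_mul]; exact hw.abs_sub_lt _ _),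
      abs_mul_add_eq (hw.two_le_abs_sub _ _) (hv.abs_sub_lt _ _), abs_mul s, habs, one_mul]
    have h1 : u x.2 - u y.2 = 0 → v x.2 - v y.2 = 0 := fun h => by
      rw [hu.eq_of_eq (sub_eq_zero.1 h), sub_self]
    have h2 := Int.sign_mul_self_eq_abs (w x.1 - w y.1)
    have h3 := sq_abs (w x.1 - w y.1)
    generalize u x.2 - u y.2 = du at *
    generalize v x.2 - v y.2 = dv at *
    generalize w x.1 - w y.1 = dw at *
    split_ifs with hdu hdw hdw
    · subst hdu hdw
      simp [h1]
    · rw [h1 hdu, hdu]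
      simp only [abs_zero, Int.sign_zero]
      linear_combination (N : ℤ) * h3
    · rw [hdw]
      simp [mul_assoc]
    · linear_combination s * du.sign * dv * h2
  unfold diffSum
  simp only [key, sum_add_distrib, ← mul_sum]
  rw [sum_sum_prod_mul (fun a c => |w a - w c|) (fun p q => |u p - u q|),
    sum_sum_prod_mul (fun a c => (w a - w c).sign) (fun p q => |u p - u q| * (v p - v q)),
    sum_sum_prod_mul (fun a c => if w a - w c = 0 then 1 else 0)
      (fun p q => |u p - u q| * |v p - v q|),
    sum_sum_prod_mul (fun a c => (w a - w c) * |w a - w c|) (fun p q => (u p - u q).sign),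
    sum_sum_prod_mul (fun a c => |w a - w c|) (fun p q => (u p - u q).sign * (v p - v q)),
    sum_sum_prod_mul (fun a c => (w a - w c) ^ 2) (fun p q => if u p - u q = 0 then 1 else 0),
    hw.sum_abs_sub, hu.sum_abs_sub, hu.sum_sign_mul_sub, hw.sum_sub_sq,
    hw.sum_ite_sub_eq_zero (fun _ _ => 1), hu.sum_ite_sub_eq_zero (fun _ _ => 1),
    sum_sum_antisymm (fun a c => (w a - w c).sign) (fun _ _ => sign_sub_comm _ _),
    sum_sum_antisymm (fun p q => (u p - u q).sign) (fun _ _ => sign_sub_comm _ _)]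
  simp only [sum_const, card_univ, hu.card_eq, hw.card_eq, nsmul_eq_mul]
  ring

theorem crossSum_step (hu : IsGrid N u) (hv : IsGrid N v) (hw : IsGrid b w)
    (hs : s = 1 ∨ s = -1) :
    crossSum (fun x : κ × ι => (b : ℤ) * u x.2 + s * w x.1)
        (fun x : κ × ι => (N : ℤ) * w x.1 + v x.2) =
      (b : ℤ) ^ 2 * crossSum u v + 4 * b * N * (∑ a, w a ^ 2) * (∑ p, u p ^ 2)
        + (N : ℤ) ^ 2 * (∑ a, ∑ c, |w a ^ 2 - w c ^ 2|) + 4 * (∑ a, |w a|) * ∑ p, |v p| := by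
  have habs : |s| = 1 := by rcases hs with rfl | rfl <;> rfl
  have key : ∀ x y : κ × ι,
      |((b : ℤ) * u x.2 + s * w x.1) - (b * u y.2 + s * w y.1)| *
        |((N : ℤ) * w x.1 + v x.2) + (N * w y.1 + v y.2)| =
      b * N * (|w x.1 + w y.1| * |u x.2 - u y.2|)
      + b * ((w x.1 + w y.1).sign * (|u x.2 - u y.2| * (v x.2 + v y.2)))
      + b * ((if w x.1 + w y.1 = 0 then 1 else 0) * (|u x.2 - u y.2| * |v x.2 + v y.2|))
      + N * s * (((w x.1 - w y.1) * |w x.1 + w y.1|) * (u x.2 - u y.2).sign)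
      + s * (((w x.1 - w y.1) * (w x.1 + w y.1).sign) * ((u x.2 - u y.2).sign * (v x.2 + v y.2)))
      + s * ((if w x.1 + w y.1 = 0 then w x.1 - w y.1 else 0) *
          ((u x.2 - u y.2).sign * |v x.2 + v y.2|))
      + N * (|w x.1 ^ 2 - w y.1 ^ 2| * (if u x.2 - u y.2 = 0 then 1 else 0))
      + (|w x.1 - w y.1| * (w x.1 + w y.1).sign) * (if u x.2 - u y.2 = 0 then v x.2 + v y.2 else 0)
      + (if w x.1 + w y.1 = 0 then |w x.1 - w y.1| else 0) *
          (if u x.2 - u y.2 = 0 then |v x.2 + v y.2| else 0) := by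
    intro x y
    rw [show ((b : ℤ) * u x.2 + s * w x.1) - (b * u y.2 + s * w y.1) =
        b * (u x.2 - u y.2) + s * (w x.1 - w y.1) by ring,
      show ((N : ℤ) * w x.1 + v x.2) + (N * w y.1 + v y.2) =
        N * (w x.1 + w y.1) + (v x.2 + v y.2) by ring,
      abs_mul_add_eq (hu.two_le_abs_sub _ _) (by rw [abs_mul, habs, one_mul]; exact hw.abs_sub_lt _ _),
      abs_mul_add_eq (hw.two_le_abs_add _ _) (hv.abs_add_lt _ _), abs_mul s, habs, one_mul,
      show w x.1 ^ 2 - w y.1 ^ 2 = (w x.1 - w y.1) * (w x.1 + w y.1) by ring, abs_mul]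
    split_ifs <;> ring
  have anti : ∀ g : ℤ → ℤ → ℤ, (∀ x y, g y x = g x y) →
      ∑ p, ∑ q, (u p - u q).sign * g (v p) (v q) = 0 := fun g hg =>
    sum_sum_antisymm _ fun p q => by rw [sign_sub_comm, hg]; ring
  have hodd : ∑ a, ∑ c, (w a + w c).sign = 0 := by
    rw [← hw.sum_sum_neg_right (fun x y => (x + y).sign)]
    exact sum_sum_antisymm _ fun a c => by rw [← Int.sign_neg]; congr 1; ring
  have hodd' : ∑ p, ∑ q, (if u p - u q = 0 then v p + v q else 0) = 0 := by
    rw [hu.sum_ite_sub_eq_zero (fun p q => v p + v q), sum_add_distrib, hv.sum_self]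
    rfl
  have habs2 : ∑ p, ∑ q, (if u p - u q = 0 then |v p + v q| else 0) = 2 * ∑ p, |v p| := by
    rw [hu.sum_ite_sub_eq_zero (fun p q => |v p + v q|), mul_sum]
    refine sum_congr rfl fun p _ => ?_
    rw [← two_mul, abs_mul, abs_two]
  have habs3 : ∑ a, ∑ c, (if w a + w c = 0 then |w a - w c| else 0) = 2 * ∑ a, |w a| := by
    rw [hw.sum_ite_add_eq_zero (fun x y => |x - y|), mul_sum]
    refine sum_congr rfl fun p _ => ?_
    rw [sub_neg_eq_add, ← two_mul, abs_mul, abs_two]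
  unfold crossSum
  simp only [key, sum_add_distrib, ← mul_sum]
  rw [sum_sum_prod_mul (fun a c => |w a + w c|) (fun p q => |u p - u q|),
    sum_sum_prod_mul (fun a c => (w a + w c).sign) (fun p q => |u p - u q| * (v p + v q)),
    sum_sum_prod_mul (fun a c => if w a + w c = 0 then 1 else 0)
      (fun p q => |u p - u q| * |v p + v q|),
    sum_sum_prod_mul (fun a c => (w a - w c) * |w a + w c|) (fun p q => (u p - u q).sign),
    sum_sum_prod_mul (fun a c => (w a - w c) * (w a + w c).sign)
      (fun p q => (u p - u q).sign * (v p + v q)),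
    sum_sum_prod_mul (fun a c => if w a + w c = 0 then w a - w c else 0)
      (fun p q => (u p - u q).sign * |v p + v q|),
    sum_sum_prod_mul (fun a c => |w a ^ 2 - w c ^ 2|) (fun p q => if u p - u q = 0 then 1 else 0),
    sum_sum_prod_mul (fun a c => |w a - w c| * (w a + w c).sign)
      (fun p q => if u p - u q = 0 then v p + v q else 0),
    sum_sum_prod_mul (fun a c => if w a + w c = 0 then |w a - w c| else 0)
      (fun p q => if u p - u q = 0 then |v p + v q| else 0),
    hw.sum_abs_add, hu.sum_abs_sub, hw.sum_ite_add_eq_zero (fun _ _ => 1),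
    hu.sum_ite_sub_eq_zero (fun _ _ => 1), hodd, hodd', habs2, habs3,
    anti (fun x y => x + y) (fun _ _ => add_comm _ _),
    anti (fun x y => |x + y|) (fun x y => by rw [add_comm]),
    sum_sum_antisymm (fun p q => (u p - u q).sign) (fun _ _ => sign_sub_comm _ _)]
  simp only [sum_const, card_univ, hu.card_eq, hw.card_eq, nsmul_eq_mul]
  ring

theorem sum_sq_mul_sq_step (hu : IsGrid N u) (hv : IsGrid N v) (hw : IsGrid b w)
    (hs : s = 1 ∨ s = -1) :
    ∑ x : κ × ι, ((b : ℤ) * u x.2 + s * w x.1) ^ 2 * ((N : ℤ) * w x.1 + v x.2) ^ 2 =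
      (b : ℤ) ^ 3 * (∑ p, u p ^ 2 * v p ^ 2)
        + (b : ℤ) ^ 2 * (N : ℤ) ^ 2 * (∑ a, w a ^ 2) * (∑ p, u p ^ 2)
        + (N : ℤ) ^ 3 * (∑ a, w a ^ 4) + (∑ a, w a ^ 2) * (∑ p, v p ^ 2)
        + 4 * s * b * N * (∑ a, w a ^ 2) * ∑ p, u p * v p := by
  have hs2 : s ^ 2 = 1 := by rcases hs with rfl | rfl <;> rfl
  have key : ∀ x : κ × ι, ((b : ℤ) * u x.2 + s * w x.1) ^ 2 * ((N : ℤ) * w x.1 + v x.2) ^ 2 =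
      (b : ℤ) ^ 2 * N ^ 2 * (w x.1 ^ 2 * u x.2 ^ 2) + (b : ℤ) ^ 2 * (u x.2 ^ 2 * v x.2 ^ 2)
      + 2 * b ^ 2 * N * (w x.1 * (u x.2 ^ 2 * v x.2))
      + 2 * b * s * N ^ 2 * (w x.1 ^ 3 * u x.2) + 4 * s * b * N * (w x.1 ^ 2 * (u x.2 * v x.2))
      + 2 * b * s * (w x.1 * (u x.2 * v x.2 ^ 2)) + (N : ℤ) ^ 2 * w x.1 ^ 4
      + 2 * N * (w x.1 ^ 3 * v x.2) + w x.1 ^ 2 * v x.2 ^ 2 := by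
    intro x
    linear_combination w x.1 ^ 2 * ((N : ℤ) * w x.1 + v x.2) ^ 2 * hs2
  simp only [key, sum_add_distrib, Fintype.sum_prod_type, ← mul_sum, ← sum_mul, hw.sum_self,
    hu.sum_self, hv.sum_self, sum_const, card_univ, hu.card_eq, hw.card_eq, nsmul_eq_mul]
  ring

end Step

/-- The combination `∑ |Δu| (|Δv| + |v_p + v_q|) - N⁻¹ ∑ u² v²` of pair and moment sums, whose
recursion over the digits does not involve the signs of the permutations. -/
def potential {ι : Type} [Fintype ι] (N : ℕ) (u v : ι → ℤ) : ℝ :=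
  (diffSum u v : ℝ) + (crossSum u v : ℝ) - ((∑ p, u p ^ 2 * v p ^ 2 : ℤ) : ℝ) / N

theorem sum_sum_comp_equiv {ι κ : Type} [Fintype ι] [Fintype κ] (e : κ ≃ ι) (f : ι → ι → ℤ) :
    ∑ k, ∑ l, f (e k) (e l) = ∑ p, ∑ q, f p q := by
  rw [← e.sum_comp]
  exact sum_congr rfl fun k _ => e.sum_comp (f (e k))

theorem potential_comp_equiv {ι κ : Type} [Fintype ι] [Fintype κ] (e : κ ≃ ι) (N : ℕ)
    (u v : ι → ℤ) : potential N (fun k => u (e k)) (fun k => v (e k)) = potential N u v := by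
  unfold potential diffSum crossSum
  rw [e.sum_comp (fun p => u p ^ 2 * v p ^ 2),
    sum_sum_comp_equiv e (fun p q => |u p - u q| * |v p - v q|),
    sum_sum_comp_equiv e (fun p q => |u p - u q| * |v p + v q|)]

theorem potential_step {ι κ : Type} [Fintype ι] [Fintype κ] {N b : ℕ} {u v : ι → ℤ} {w : κ → ℤ}
    {s : ℤ} (hN : N ≠ 0) (hb : b ≠ 0) (hu : IsGrid N u) (hv : IsGrid N v) (hw : IsGrid b w)
    (hs : s = 1 ∨ s = -1) :
    potential (b * N) (fun x : κ × ι => (b : ℤ) * u x.2 + s * w x.1)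
        (fun x : κ × ι => (N : ℤ) * w x.1 + v x.2) =
      (b : ℝ) ^ 2 * potential N u v
        + (8 * (b : ℝ) ^ 2 * (b ^ 2 - 1) * N ^ 2 * (N ^ 2 - 1)) / 9
        + 2 * (b : ℝ) ^ 2 * (b ^ 2 - 1) * N ^ 2 / 3
        + (N : ℝ) ^ 2 * (b ^ 2 * (b ^ 2 - 4) / 3 + (b % 2 : ℕ))
        + ((b : ℝ) ^ 2 - (b % 2 : ℕ)) * ((N : ℝ) ^ 2 - (N % 2 : ℕ))
        - (b : ℝ) ^ 2 * (b ^ 2 - 1) * N ^ 2 * (N ^ 2 - 1) / 9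
        - (N : ℝ) ^ 2 * (b ^ 2 - 1) * (3 * b ^ 2 - 7) / 15
        - ((b : ℝ) ^ 2 - 1) * ((N : ℝ) ^ 2 - 1) / 9 := by
  have hN' : (N : ℝ) ≠ 0 := by exact_mod_cast hN
  have hb' : (b : ℝ) ≠ 0 := by exact_mod_cast hb
  unfold potential
  rw [diffSum_step hu hv hw hs, crossSum_step hu hv hw hs, sum_sq_mul_sq_step hu hv hw hs]
  have h1 := hw.sum_sq
  have h2 := hu.sum_sq
  have h3 := hv.sum_sq
  have h4 := hw.sum_pow_four
  have h5 := hw.sum_abs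
  have h6 := hv.sum_abs
  have h7 := hw.sum_abs_sq_sub_sq
  generalize ∑ a, w a ^ 2 = w2 at *
  generalize ∑ p, u p ^ 2 = u2 at *
  generalize ∑ p, v p ^ 2 = v2 at *
  generalize ∑ a, w a ^ 4 = w4 at *
  generalize ∑ a, |w a| = wa at *
  generalize ∑ p, |v p| = va at *
  generalize ∑ a, ∑ c, |w a ^ 2 - w c ^ 2| = wr at *
  generalize ∑ p, u p * v p = uv at *
  generalize ∑ p, u p ^ 2 * v p ^ 2 = f at *
  generalize b % 2 = db at *
  generalize N % 2 = dN at *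
  have e1 : (w2 : ℝ) = b * (b ^ 2 - 1) / 3 := by
    have : (3 : ℝ) * w2 = b * (b ^ 2 - 1) := by exact_mod_cast h1
    linarith
  have e2 : (u2 : ℝ) = N * (N ^ 2 - 1) / 3 := by
    have : (3 : ℝ) * u2 = N * (N ^ 2 - 1) := by exact_mod_cast h2
    linarith
  have e3 : (v2 : ℝ) = N * (N ^ 2 - 1) / 3 := by
    have : (3 : ℝ) * v2 = N * (N ^ 2 - 1) := by exact_mod_cast h3
    linarith
  have e4 : (w4 : ℝ) = b * (b ^ 2 - 1) * (3 * b ^ 2 - 7) / 15 := by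
    have : (15 : ℝ) * w4 = b * (b ^ 2 - 1) * (3 * b ^ 2 - 7) := by exact_mod_cast h4
    linarith
  have e5 : (wa : ℝ) = (b ^ 2 - db) / 2 := by
    have : (2 : ℝ) * wa = b ^ 2 - db := by exact_mod_cast h5
    linarith
  have e6 : (va : ℝ) = (N ^ 2 - dN) / 2 := by
    have : (2 : ℝ) * va = N ^ 2 - dN := by exact_mod_cast h6
    linarith
  have e7 : (wr : ℝ) = b ^ 2 * (b ^ 2 - 4) / 3 + db := by
    have : (3 : ℝ) * wr = b ^ 2 * (b ^ 2 - 4) + 3 * db := by exact_mod_cast h7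
    linarith
  push_cast
  rw [e1, e2, e3, e4, e5, e6, e7]
  field_simp
  ring

/-- The centred value `2 * k - (b - 1)` of the digit `k`. -/
def centre {b : ℕ} (k : Fin b) : ℤ := 2 * ((k : ℕ) : ℤ) - ((b : ℤ) - 1)

/-- Centred and rescaled first coordinate of `hammPt`. -/
def centreX (b n : ℕ) (S : Fin n → Equiv.Perm (Fin b)) (a : Fin n → Fin b) : ℤ :=
  ∑ j : Fin n, (b : ℤ) ^ (j : ℕ) * centre (S j (a j))

/-- Centred and rescaled second coordinate of `hammPt`. -/
def centreY (b n : ℕ) (a : Fin n → Fin b) : ℤ :=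
  ∑ j : Fin n, (b : ℤ) ^ (n - 1 - (j : ℕ)) * centre (a j)

theorem centre_rev {b : ℕ} (k : Fin b) : centre k.rev = -centre k := by
  have := k.isLt
  simp only [centre, Fin.val_rev]
  omega

theorem centre_pbar {b : ℕ} (σ : Equiv.Perm (Fin b)) (k : Fin b) :
    centre (pbar σ k) = -centre (σ k) := centre_rev _

theorem exists_sign {b : ℕ} {σ : Equiv.Perm (Fin b)} (h : σ = 1 ∨ σ = tauP b) :
    ∃ s : ℤ, (s = 1 ∨ s = -1) ∧ ∀ k, centre (σ k) = s * centre k := by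
  rcases h with rfl | rfl
  · exact ⟨1, Or.inl rfl, fun k => by simp⟩
  · exact ⟨-1, Or.inr rfl, fun k => by rw [neg_one_mul, ← centre_rev]; rfl⟩

theorem isGrid_centre (b : ℕ) : IsGrid b (centre (b := b)) := IsGrid.fin b

theorem centreX_cons {b n : ℕ} (S : Fin (n + 1) → Equiv.Perm (Fin b)) (x : Fin b)
    (a : Fin n → Fin b) :
    centreX b (n + 1) S (Fin.cons x a) =
      b * centreX b n (fun j => S j.succ) a + centre (S 0 x) := by
  simp only [centreX, Fin.sum_univ_succ, Fin.cons_zero, Fin.cons_succ, Fin.val_zero, Fin.val_succ,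
    pow_zero, one_mul, mul_sum]
  rw [add_comm]
  congr 1
  exact sum_congr rfl fun j _ => by ring

theorem centreY_cons {b n : ℕ} (x : Fin b) (a : Fin n → Fin b) :
    centreY b (n + 1) (Fin.cons x a) = ((b ^ n : ℕ) : ℤ) * centre x + centreY b n a := by
  simp only [centreY, Fin.sum_univ_succ, Fin.cons_zero, Fin.cons_succ, Fin.val_zero, Fin.val_succ]
  push_cast
  congr 1
  exact sum_congr rfl fun j _ => by congr 2; omega

/-- Splitting off the first digit. -/
def consEquiv (b n : ℕ) : Fin b × (Fin n → Fin b) ≃ (Fin (n + 1) → Fin b) :=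
  Fin.consEquiv fun _ => Fin b

theorem consEquiv_apply {b n : ℕ} (x : Fin b × (Fin n → Fin b)) :
    consEquiv b n x = Fin.cons x.1 x.2 := rfl

theorem isGrid_of_unique {ι : Type} [Unique ι] {u : ι → ℤ} (h : u default = 0) : IsGrid 1 u :=
  ⟨Equiv.ofUnique ι (Fin 1), fun p => by rw [Unique.eq_default p, h]; simp⟩

theorem isGrid_centreX (b : ℕ) : ∀ (n : ℕ) (S : Fin n → Equiv.Perm (Fin b)),
    IsGrid (b ^ n) (centreX b n S)
  | 0, S => isGrid_of_unique (by simp [centreX])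
  | n + 1, S => by
    apply IsGrid.of_comp_equiv (consEquiv b n)
    simp only [consEquiv_apply, centreX_cons]
    exact ((isGrid_centreX b n fun j => S j.succ).prod
      ((isGrid_centre b).comp_equiv (S 0))).comp_equiv (Equiv.prodComm _ _)

theorem isGrid_centreY (b : ℕ) : ∀ n : ℕ, IsGrid (b ^ n) (centreY b n)
  | 0 => isGrid_of_unique (by simp [centreY])
  | n + 1 => by
    apply IsGrid.of_comp_equiv (consEquiv b n)
    simp only [consEquiv_apply, centreY_cons, pow_succ']
    exact (isGrid_centre b).prod (isGrid_centreY b n)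

theorem potential_centre_succ {b n : ℕ} (S : Fin (n + 1) → Equiv.Perm (Fin b)) {s : ℤ}
    (hs : ∀ k, centre (S 0 k) = s * centre k) :
    potential (b ^ (n + 1)) (centreX b (n + 1) S) (centreY b (n + 1)) =
      potential (b * b ^ n)
        (fun x : Fin b × (Fin n → Fin b) =>
          (b : ℤ) * centreX b n (fun j => S j.succ) x.2 + s * centre x.1)
        (fun x : Fin b × (Fin n → Fin b) => ((b ^ n : ℕ) : ℤ) * centre x.1 + centreY b n x.2) := by
  rw [← potential_comp_equiv (consEquiv b n), pow_succ']
  simp only [consEquiv_apply, centreX_cons, centreY_cons, hs]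

theorem potential_centre {b n : ℕ} (hb : b ≠ 0) (hn : 1 ≤ n) (S : Fin n → Equiv.Perm (Fin b))
    (hS : ∀ i, S i = 1 ∨ S i = tauP b) :
    potential (b ^ n) (centreX b n S) (centreY b n) =
      8 * n * ((b : ℝ) ^ 2 / 360 + 1 / 24 - 2 / (45 * (b : ℝ) ^ 2)) * ((b : ℝ) ^ n) ^ 2
        + 7 / 9 * ((b : ℝ) ^ n) ^ 4 - 5 / 3 * ((b : ℝ) ^ n) ^ 2 - 1 / 9 + (b % 2 : ℕ) := by
  have hb' : (b : ℝ) ≠ 0 := by exact_mod_cast hb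
  induction n, hn using Nat.le_induction with
  | base =>
    obtain ⟨s, hs, hs'⟩ := exists_sign (hS 0)
    rw [potential_centre_succ S hs', potential_step (pow_ne_zero _ hb) hb (isGrid_centreX b 0 _)
      (isGrid_centreY b 0) (isGrid_centre b) hs]
    have h0 : potential (b ^ 0) (centreX b 0 fun j => S j.succ) (centreY b 0) = 0 := by
      simp [potential, diffSum, crossSum, centreX, centreY]
    rw [h0]
    simp
    field_simp
    ring
  | succ n hn ih =>
    obtain ⟨s, hs, hs'⟩ := exists_sign (hS 0)
    rw [potential_centre_succ S hs', potential_step (pow_ne_zero _ hb) hb (isGrid_centreX b n _)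
      (isGrid_centreY b n) (isGrid_centre b) hs, ih _ fun i => hS i.succ]
    have hmod : b ^ n % 2 = b % 2 := by
      rcases Nat.mod_two_eq_zero_or_one b with h | h <;>
        simp [Nat.pow_mod, h, Nat.one_le_iff_ne_zero.1 hn]
    have hsq : ((b % 2 : ℕ) : ℝ) ^ 2 = (b % 2 : ℕ) := by
      rcases Nat.mod_two_eq_zero_or_one b with h | h <;> simp [h]
    rw [hmod]
    rw [pow_succ (b : ℝ) n]
    push_cast
    have hk : ((b : ℝ) ^ 2 / 360 + 1 / 24 - 2 / (45 * (b : ℝ) ^ 2)) * (b : ℝ) ^ 2 =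
        (b : ℝ) ^ 4 / 360 + (b : ℝ) ^ 2 / 24 - 2 / 45 := by field_simp
    generalize (b : ℝ) ^ 2 / 360 + 1 / 24 - 2 / (45 * (b : ℝ) ^ 2) = κ at hk
    generalize (b : ℝ) ^ n = M
    generalize ((b % 2 : ℕ) : ℝ) = d at hsq
    linear_combination hsq - 8 * M ^ 2 * hk

/-- The factors, in one coordinate, of the terms of the local discrepancy: the indicator of
`(z i, ∞)` for a point `i`, and the coordinate itself for the volume term. -/
def coordFactor {ι : Type} (z : ι → ℝ) : Option ι → ℝ → ℝ
  | none, t => t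
  | some i, t => if z i < t then 1 else 0

/-- The integrals of the products of two coordinate factors. -/
def gramFactor {ι : Type} (z : ι → ℝ) : Option ι → Option ι → ℝ
  | none, none => 1 / 3
  | none, some i => (1 - z i ^ 2) / 2
  | some i, none => (1 - z i ^ 2) / 2
  | some i, some j => 1 - max (z i) (z j)

theorem coordFactor_monotone {ι : Type} (z : ι → ℝ) (o : Option ι) : Monotone (coordFactor z o) := by
  intro s t hst
  cases o with
  | none => exact hst
  | some i =>
    simp only [coordFactor]
    split_ifs <;> linarith

theorem coordFactor_nonneg {ι : Type} (z : ι → ℝ) (o : Option ι) {t : ℝ} (ht : 0 ≤ t) :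
    0 ≤ coordFactor z o t := by
  cases o with
  | none => exact ht
  | some i =>
    simp only [coordFactor]
    split_ifs <;> norm_num

theorem intervalIntegrable_coordFactor_mul {ι : Type} (z : ι → ℝ) (o o' : Option ι) :
    IntervalIntegrable (fun t => coordFactor z o t * coordFactor z o' t)
      MeasureTheory.volume 0 1 := by
  apply MonotoneOn.intervalIntegrable
  rw [Set.uIcc_of_le zero_le_one]
  intro s hs t ht hst
  exact mul_le_mul (coordFactor_monotone z o hst) (coordFactor_monotone z o' hst)
    (coordFactor_nonneg z o' hs.1) (coordFactor_nonneg z o ht.1)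

theorem integral_ite_lt {c : ℝ} (h0 : 0 ≤ c) (h1 : c ≤ 1) (f : ℝ → ℝ) :
    ∫ t in (0 : ℝ)..1, (if c < t then f t else 0) = ∫ t in c..1, f t := by
  rw [intervalIntegral.integral_of_le zero_le_one, intervalIntegral.integral_of_le h1]
  have h : (fun t => if c < t then f t else 0) = (Set.Ioi c).indicator f := by
    funext t
    simp only [Set.indicator_apply, Set.mem_Ioi]
  rw [h, MeasureTheory.setIntegral_indicator measurableSet_Ioi]
  congr 2
  ext t
  simp only [Set.mem_inter_iff, Set.mem_Ioc, Set.mem_Ioi]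
  constructor
  · rintro ⟨⟨-, h2⟩, h3⟩
    exact ⟨h3, h2⟩
  · rintro ⟨h3, h2⟩
    exact ⟨⟨h0.trans_lt h3, h2⟩, h3⟩

theorem integral_coordFactor_mul {ι : Type} {z : ι → ℝ} (hz0 : ∀ i, 0 ≤ z i) (hz1 : ∀ i, z i ≤ 1)
    (o o' : Option ι) :
    ∫ t in (0 : ℝ)..1, coordFactor z o t * coordFactor z o' t = gramFactor z o o' := by
  rcases o with _ | i <;> rcases o' with _ | j <;> simp only [coordFactor, gramFactor]
  · simp only [← sq, integral_pow]
    norm_num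
  · simp only [mul_ite, mul_one, mul_zero]
    rw [integral_ite_lt (hz0 j) (hz1 j), integral_id]
    norm_num
  · simp only [ite_mul, one_mul, zero_mul]
    rw [integral_ite_lt (hz0 i) (hz1 i), integral_id]
    norm_num
  · simp only [ite_mul, one_mul, zero_mul, ← ite_and, ← max_lt_iff]
    rw [integral_ite_lt (le_max_of_le_left (hz0 i)) (max_le (hz1 i) (hz1 j)) (fun _ => 1)]
    simp

theorem integral_sum_sum_coordFactor_mul {ι : Type} [Fintype ι] {z : ι → ℝ} (hz0 : ∀ i, 0 ≤ z i)
    (hz1 : ∀ i, z i ≤ 1) (k : Option ι → Option ι → ℝ) :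
    ∫ t in (0 : ℝ)..1, ∑ o, ∑ o', k o o' * (coordFactor z o t * coordFactor z o' t) =
      ∑ o, ∑ o', k o o' * gramFactor z o o' := by
  simp only [← Fintype.sum_prod_type' (fun o o' => k o o' * _)]
  rw [intervalIntegral.integral_finsetSum fun x _ =>
    (intervalIntegrable_coordFactor_mul z x.1 x.2).const_mul _]
  refine sum_congr rfl fun x _ => ?_
  rw [intervalIntegral.integral_const_mul, integral_coordFactor_mul hz0 hz1]

theorem localDisc_eq_sum {ι : Type} [Fintype ι] (P : ι → ℝ × ℝ) (hx : ∀ i, 0 ≤ (P i).1)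
    (hy : ∀ i, 0 ≤ (P i).2) (x y : ℝ) :
    localDisc P x y = ∑ o : Option ι, (o.elim (-(Fintype.card ι : ℝ)) fun _ => 1) *
      (coordFactor (fun i => (P i).1) o x * coordFactor (fun i => (P i).2) o y) := by
  rw [Fintype.sum_option, localDisc, card_filter]
  simp only [Option.elim, coordFactor, hx, hy, true_and, one_mul, ite_mul, zero_mul, ← ite_and]
  push_cast
  ring

/-- Warnock's formula. -/
theorem integral_localDisc_sq {ι : Type} [Fintype ι] (P : ι → ℝ × ℝ)
    (hx0 : ∀ i, 0 ≤ (P i).1) (hx1 : ∀ i, (P i).1 ≤ 1)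
    (hy0 : ∀ i, 0 ≤ (P i).2) (hy1 : ∀ i, (P i).2 ≤ 1) :
    ∫ x in (0 : ℝ)..1, ∫ y in (0 : ℝ)..1, (localDisc P x y) ^ 2 =
      (Fintype.card ι : ℝ) ^ 2 / 9
        - (Fintype.card ι : ℝ) / 2 * ∑ i, (1 - (P i).1 ^ 2) * (1 - (P i).2 ^ 2)
        + ∑ i, ∑ j, (1 - max (P i).1 (P j).1) * (1 - max (P i).2 (P j).2) := by
  set c : Option ι → ℝ := fun o => o.elim (-(Fintype.card ι : ℝ)) fun _ => 1 with hc
  set zx : ι → ℝ := fun i => (P i).1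
  set zy : ι → ℝ := fun i => (P i).2
  have hsq : ∀ x y, (localDisc P x y) ^ 2 = ∑ o, ∑ o', c o * c o' *
      (coordFactor zx o x * coordFactor zx o' x) * (coordFactor zy o y * coordFactor zy o' y) := by
    intro x y
    rw [localDisc_eq_sum P hx0 hy0, sq, sum_mul_sum]
    exact sum_congr rfl fun o _ => sum_congr rfl fun o' _ => by ring
  have hout : ∫ x in (0 : ℝ)..1, ∫ y in (0 : ℝ)..1, (localDisc P x y) ^ 2 =
      ∑ o, ∑ o', c o * c o' * gramFactor zy o o' * gramFactor zx o o' := by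
    simp only [hsq]
    rw [← integral_sum_sum_coordFactor_mul hx0 hx1]
    congr 1 with x
    rw [integral_sum_sum_coordFactor_mul hy0 hy1]
    exact sum_congr rfl fun o _ => sum_congr rfl fun o' _ => by ring
  rw [hout]
  simp only [Fintype.sum_option, hc, Option.elim, gramFactor, sum_add_distrib, one_mul]
  have h1 : ∑ i, -(Fintype.card ι : ℝ) * 1 * ((1 - zy i ^ 2) / 2) * ((1 - zx i ^ 2) / 2) =
      -(Fintype.card ι : ℝ) / 4 * ∑ i, (1 - (P i).1 ^ 2) * (1 - (P i).2 ^ 2) := by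
    rw [mul_sum]
    exact sum_congr rfl fun i _ => by ring
  have h2 : ∑ i, -(Fintype.card ι : ℝ) * ((1 - zy i ^ 2) / 2) * ((1 - zx i ^ 2) / 2) =
      -(Fintype.card ι : ℝ) / 4 * ∑ i, (1 - (P i).1 ^ 2) * (1 - (P i).2 ^ 2) := by
    rw [mul_sum]
    exact sum_congr rfl fun i _ => by ring
  have h3 : ∑ i, ∑ j, (1 - max (zy i) (zy j)) * (1 - max (zx i) (zx j)) =
      ∑ i, ∑ j, (1 - max (P i).1 (P j).1) * (1 - max (P i).2 (P j).2) :=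
    sum_congr rfl fun i _ => sum_congr rfl fun j _ => mul_comm _ _
  rw [h1, h2, h3]
  ring

theorem centreX_rev {b n : ℕ} {S : Fin n → Equiv.Perm (Fin b)}
    (hS : ∀ i, S i = 1 ∨ S i = tauP b) (a : Fin n → Fin b) :
    centreX b n S (fun i => (a i).rev) = -centreX b n S a := by
  simp only [centreX, ← sum_neg_distrib]
  refine sum_congr rfl fun i _ => ?_
  obtain ⟨s, -, hs⟩ := exists_sign (hS i)
  rw [hs, hs, centre_rev]
  ring

theorem centreY_rev {b n : ℕ} (a : Fin n → Fin b) :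
    centreY b n (fun i => (a i).rev) = -centreY b n a := by
  simp only [centreY, ← sum_neg_distrib, centre_rev, mul_neg]

theorem centreX_pbar {b n : ℕ} (S : Fin n → Equiv.Perm (Fin b)) (a : Fin n → Fin b) :
    centreX b n (fun i => pbar (S i)) a = -centreX b n S a := by
  simp only [centreX, ← sum_neg_distrib, centre_pbar, mul_neg]

/-- The coordinate in `[0, 1)` of the centred grid value `t`. -/
def gridCoord (N : ℕ) (t : ℝ) : ℝ := (t + (N - 1)) / (2 * N)

theorem hammPt_fst {b n : ℕ} (hb : b ≠ 0) (S : Fin n → Equiv.Perm (Fin b)) (a : Fin n → Fin b) :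
    (hammPt b n S a).1 = gridCoord (b ^ n) (centreX b n S a) := by
  have hb' : (b : ℝ) ≠ 0 := by exact_mod_cast hb
  have hgeom := geom_sum_mul (b : ℝ) n
  rw [← Fin.sum_univ_eq_sum_range (fun i => (b : ℝ) ^ i), sum_mul] at hgeom
  rw [gridCoord, eq_div_iff (by positivity)]
  simp only [hammPt, centreX, centre]
  push_cast
  rw [← hgeom, ← sum_add_distrib, sum_mul]
  refine sum_congr rfl fun j _ => ?_
  have hpow : (b : ℝ) ^ n = (b : ℝ) ^ (n - (j : ℕ)) * (b : ℝ) ^ (j : ℕ) := by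
    rw [← pow_add, Nat.sub_add_cancel j.isLt.le]
  rw [hpow]
  field_simp
  ring

theorem hammPt_snd {b n : ℕ} (hb : b ≠ 0) (S : Fin n → Equiv.Perm (Fin b)) (a : Fin n → Fin b) :
    (hammPt b n S a).2 = gridCoord (b ^ n) (centreY b n a) := by
  have hb' : (b : ℝ) ≠ 0 := by exact_mod_cast hb
  have hgeom := geom_sum_mul (b : ℝ) n
  rw [← sum_range_reflect, ← Fin.sum_univ_eq_sum_range (fun i => (b : ℝ) ^ (n - 1 - i)),
    sum_mul] at hgeom
  rw [gridCoord, eq_div_iff (by positivity)]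
  simp only [hammPt, centreY, centre]
  push_cast
  rw [← hgeom, ← sum_add_distrib, sum_mul]
  refine sum_congr rfl fun j _ => ?_
  have hpow : (b : ℝ) ^ n = (b : ℝ) ^ ((j : ℕ) + 1) * (b : ℝ) ^ (n - 1 - (j : ℕ)) := by
    rw [← pow_add]
    congr 1
    omega
  rw [hpow]
  field_simp
  ring

theorem IsGrid.gridCoord_mem {ι : Type} {N : ℕ} {u : ι → ℤ} (hu : IsGrid N u) (p : ι) :
    0 ≤ gridCoord N (u p) ∧ gridCoord N (u p) ≤ 1 := by
  obtain ⟨e, he⟩ := hu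
  have h := (e p).isLt
  have hN : (0 : ℝ) < N := by exact_mod_cast (Nat.zero_le _).trans_lt h
  have h' : ((e p : ℕ) : ℝ) < N := by exact_mod_cast h
  rw [gridCoord, he]
  push_cast
  constructor
  · apply div_nonneg _ (by positivity)
    linarith [Nat.cast_nonneg (α := ℝ) (e p : ℕ)]
  · rw [div_le_one (by positivity)]
    linarith

theorem one_sub_max_gridCoord {N : ℕ} (hN : N ≠ 0) (s t : ℝ) :
    1 - max (gridCoord N s) (gridCoord N t) = (2 * (N + 1) - s - t - |s - t|) / (4 * N) := by
  have hN' : (0 : ℝ) < N := by exact_mod_cast Nat.pos_of_ne_zero hN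
  have hmono : Monotone (gridCoord N) := fun x y hxy => by
    unfold gridCoord
    gcongr
  rw [← hmono.map_max, gridCoord]
  rcases le_total s t with h | h
  · rw [max_eq_right h, abs_of_nonpos (by linarith)]
    field_simp
    ring
  · rw [max_eq_left h, abs_of_nonneg (by linarith)]
    field_simp
    ring

theorem sum_sum_odd {ι : Type} [Fintype ι] (e : ι ≃ ι) (f : ι → ι → ℤ)
    (hf : ∀ p q, f (e p) (e q) = -f p q) : ∑ p, ∑ q, f p q = 0 := by
  have h := sum_sum_comp_equiv e f
  simp only [hf, sum_neg_distrib] at h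
  omega

section Symmetrized

variable {ι : Type} [Fintype ι] {N : ℕ} {u v : ι → ℤ}

theorem sum_one_sub_sq (hN : N ≠ 0) (hu : IsGrid N u) (hv : IsGrid N v) (e : ι ≃ ι)
    (heu : ∀ p, u (e p) = -u p) (hev : ∀ p, v (e p) = -v p) :
    ∑ p, ((1 - gridCoord N (u p) ^ 2) * (1 - gridCoord N (v p) ^ 2) +
        (1 - gridCoord N (-u p) ^ 2) * (1 - gridCoord N (v p) ^ 2)) =
      (((3 * (N : ℝ) - 1) * (N + 1)) ^ 2 * N
        - 2 * ((3 * (N : ℝ) - 1) * (N + 1)) * (N * (N ^ 2 - 1) / 3)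
        + ((∑ p, u p ^ 2 * v p ^ 2 : ℤ) : ℝ)) / (8 * (N : ℝ) ^ 4) := by
  have hN' : (N : ℝ) ≠ 0 := by exact_mod_cast hN
  have hodd : ∑ p, u p ^ 2 * v p = 0 := by
    have h := e.sum_comp fun p => u p ^ 2 * v p
    simp only [heu, hev, neg_sq, mul_neg, sum_neg_distrib] at h
    omega
  have hu2 : 3 * ∑ p, (u p : ℝ) ^ 2 = N * ((N : ℝ) ^ 2 - 1) := by exact_mod_cast hu.sum_sq
  have hv2 : 3 * ∑ p, (v p : ℝ) ^ 2 = N * ((N : ℝ) ^ 2 - 1) := by exact_mod_cast hv.sum_sq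
  have hv1 : ∑ p, (v p : ℝ) = 0 := by exact_mod_cast hv.sum_self
  have hodd' : ∑ p, (u p : ℝ) ^ 2 * v p = 0 := by exact_mod_cast hodd
  have key : ∀ p, (1 - gridCoord N (u p) ^ 2) * (1 - gridCoord N (v p) ^ 2) +
        (1 - gridCoord N (-u p) ^ 2) * (1 - gridCoord N (v p) ^ 2) =
      1 / (8 * (N : ℝ) ^ 4) * (((3 * (N : ℝ) - 1) * (N + 1)) ^ 2
        - ((3 * (N : ℝ) - 1) * (N + 1)) * (u p : ℝ) ^ 2
        - ((3 * (N : ℝ) - 1) * (N + 1)) * (v p : ℝ) ^ 2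
        - 2 * (N - 1) * ((3 * (N : ℝ) - 1) * (N + 1)) * v p
        + (u p : ℝ) ^ 2 * (v p : ℝ) ^ 2 + 2 * (N - 1) * ((u p : ℝ) ^ 2 * v p)) := by
    intro p
    unfold gridCoord
    field_simp
    ring
  simp only [key, ← mul_sum, sum_add_distrib, sum_sub_distrib, hv1, hodd', sum_const, card_univ,
    hu.card_eq, nsmul_eq_mul]
  push_cast
  have e1 : ∑ p, (u p : ℝ) ^ 2 = N * ((N : ℝ) ^ 2 - 1) / 3 := by linarith
  have e2 : ∑ p, (v p : ℝ) ^ 2 = N * ((N : ℝ) ^ 2 - 1) / 3 := by linarith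
  rw [e1, e2]
  ring

theorem sum_sum_one_sub_max (hN : N ≠ 0) (hu : IsGrid N u) (hv : IsGrid N v) (e : ι ≃ ι)
    (heu : ∀ p, u (e p) = -u p) (hev : ∀ p, v (e p) = -v p) :
    ∑ p, ∑ q, ((1 - max (gridCoord N (u p)) (gridCoord N (u q))) +
        (1 - max (gridCoord N (u p)) (gridCoord N (-u q))) +
        (1 - max (gridCoord N (-u p)) (gridCoord N (u q))) +
        (1 - max (gridCoord N (-u p)) (gridCoord N (-u q)))) *
          (1 - max (gridCoord N (v p)) (gridCoord N (v q))) =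
      (N + 1) ^ 2 - 2 * (N + 1) * ((N : ℝ) ^ 2 - 1) / (3 * N)
        + ((diffSum u v : ℝ) + crossSum u v) / (8 * (N : ℝ) ^ 2) := by
  have hN' : (N : ℝ) ≠ 0 := by exact_mod_cast hN
  have habs1 : ∀ x y : ℝ, |x - -y| = |x + y| := fun x y => by rw [sub_neg_eq_add]
  have habs2 : ∀ x y : ℝ, |-x - y| = |x + y| := fun x y => by rw [← abs_neg]; congr 1; ring
  have habs3 : ∀ x y : ℝ, |-x - -y| = |x - y| := fun x y => by rw [← abs_neg]; congr 1; ring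
  have key : ∀ p q, ((1 - max (gridCoord N (u p)) (gridCoord N (u q))) +
        (1 - max (gridCoord N (u p)) (gridCoord N (-u q))) +
        (1 - max (gridCoord N (-u p)) (gridCoord N (u q))) +
        (1 - max (gridCoord N (-u p)) (gridCoord N (-u q)))) *
          (1 - max (gridCoord N (v p)) (gridCoord N (v q))) =
      1 / (8 * (N : ℝ) ^ 2) * (((8 * (N + 1) ^ 2
        - 4 * (N + 1) * (v p + v q) - 4 * (N + 1) * |v p - v q| - 2 * (N + 1) * |u p - u q|
        - 2 * (N + 1) * |u p + u q| + (v p + v q) * (|u p - u q| + |u p + u q|)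
        + |u p - u q| * |v p - v q| + |u p + u q| * |v p - v q| : ℤ)) : ℝ) := by
    intro p q
    simp only [one_sub_max_gridCoord hN]
    rw [habs3, habs1, habs2]
    push_cast
    field_simp
    ring
  have hodd : ∑ p, ∑ q, (v p + v q) * (|u p - u q| + |u p + u q|) = 0 := by
    refine sum_sum_odd e _ fun p q => ?_
    rw [heu, heu, hev, hev, ← abs_neg (-u p - -u q), ← abs_neg (-u p + -u q)]
    ring_nf
  have hcross : ∑ p, ∑ q, |u p + u q| * |v p - v q| = crossSum u v := by
    refine sum_congr rfl fun p _ => ?_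
    rw [← e.sum_comp]
    simp only [heu, hev, sub_neg_eq_add, ← sub_eq_add_neg]
  have hdiff : ∑ p, ∑ q, |u p - u q| * |v p - v q| = diffSum u v := rfl
  have hlin : ∑ p, ∑ q, (v p + v q) = 0 := by
    simp only [sum_add_distrib, sum_const, ← smul_sum, hv.sum_self, smul_zero, add_zero]
  have hu2 : ((∑ p, u p ^ 2 : ℤ) : ℝ) = N * ((N : ℝ) ^ 2 - 1) / 3 := by
    have : 3 * ((∑ p, u p ^ 2 : ℤ) : ℝ) = N * ((N : ℝ) ^ 2 - 1) := by exact_mod_cast hu.sum_sq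
    linarith
  have hv2 : ((∑ p, v p ^ 2 : ℤ) : ℝ) = N * ((N : ℝ) ^ 2 - 1) / 3 := by
    have : 3 * ((∑ p, v p ^ 2 : ℤ) : ℝ) = N * ((N : ℝ) ^ 2 - 1) := by exact_mod_cast hv.sum_sq
    linarith
  have hsum : ∑ p, ∑ q, (8 * ((N : ℤ) + 1) ^ 2 - 4 * (N + 1) * (v p + v q)
        - 4 * (N + 1) * |v p - v q| - 2 * (N + 1) * |u p - u q| - 2 * (N + 1) * |u p + u q|
        + (v p + v q) * (|u p - u q| + |u p + u q|)
        + |u p - u q| * |v p - v q| + |u p + u q| * |v p - v q|) =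
      8 * ((N : ℤ) + 1) ^ 2 * N ^ 2 - 8 * (N + 1) * (∑ p, v p ^ 2) - 8 * (N + 1) * (∑ p, u p ^ 2)
        + diffSum u v + crossSum u v := by
    have hconst : ∑ _p : ι, ∑ _q : ι, 8 * ((N : ℤ) + 1) ^ 2 = 8 * ((N : ℤ) + 1) ^ 2 * N ^ 2 := by
      simp only [sum_const, card_univ, hu.card_eq, nsmul_eq_mul]
      ring
    have hlin' : ∑ p, ∑ q, 4 * ((N : ℤ) + 1) * (v p + v q) = 0 := by
      simp only [← mul_sum, hlin, mul_zero]
    simp only [sum_add_distrib (f := fun _ => _ + _ + _), sum_add_distrib (f := fun _ => _ - _ + _),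
      sum_add_distrib (f := fun _ => _ - _), sum_sub_distrib, hconst, hlin', hodd, hcross, hdiff]
    simp only [← mul_sum, hu.sum_abs_sub, hu.sum_abs_add, hv.sum_abs_sub]
    ring
  simp only [key, ← mul_sum, ← Int.cast_sum]
  rw [hsum]
  simp only [Int.cast_add, Int.cast_sub, Int.cast_mul, hu2, hv2]
  push_cast
  field_simp
  ring

end Symmetrized

theorem symFam_fst {b n : ℕ} (hb : b ≠ 0) (S : Fin n → Equiv.Perm (Fin b))
    (i : Bool × (Fin n → Fin b)) : (symFam b n S i).1 =
      gridCoord (b ^ n) (if i.1 then (centreX b n S i.2 : ℝ) else -(centreX b n S i.2 : ℝ)) := by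
  rcases i with ⟨_ | _, a⟩ <;> simp [symFam, hammPt_fst hb, centreX_pbar]

theorem symFam_snd {b n : ℕ} (hb : b ≠ 0) (S : Fin n → Equiv.Perm (Fin b))
    (i : Bool × (Fin n → Fin b)) : (symFam b n S i).2 = gridCoord (b ^ n) (centreY b n i.2) := by
  rcases i with ⟨_ | _, a⟩ <;> simp [symFam, hammPt_snd hb]

theorem integral_localDisc_symFam {b n : ℕ} (hb : b ≠ 0) (S : Fin n → Equiv.Perm (Fin b))
    (hS : ∀ i, S i = 1 ∨ S i = tauP b) :
    ∫ x in (0 : ℝ)..1, ∫ y in (0 : ℝ)..1, (localDisc (symFam b n S) x y) ^ 2 =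
      19 / 12 - 7 / 72 * ((b : ℝ) ^ n) ^ 2 + 1 / (b : ℝ) ^ n - 1 / (24 * ((b : ℝ) ^ n) ^ 2)
        + potential (b ^ n) (centreX b n S) (centreY b n) / (8 * ((b : ℝ) ^ n) ^ 2) := by
  have hN : b ^ n ≠ 0 := pow_ne_zero _ hb
  have hN' : (b : ℝ) ^ n ≠ 0 := by exact_mod_cast hN
  have hu := isGrid_centreX b n S
  have hv := isGrid_centreY b n
  have hx : ∀ i, 0 ≤ (symFam b n S i).1 ∧ (symFam b n S i).1 ≤ 1 := by
    intro i
    rw [symFam_fst hb]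
    split_ifs
    · exact hu.gridCoord_mem _
    · have h := hu.neg.gridCoord_mem i.2
      rwa [Int.cast_neg] at h
  have hy : ∀ i, 0 ≤ (symFam b n S i).2 ∧ (symFam b n S i).2 ≤ 1 := by
    intro i
    rw [symFam_snd hb]
    exact hv.gridCoord_mem _
  have hcard : (Fintype.card (Bool × (Fin n → Fin b)) : ℝ) = 2 * (b : ℝ) ^ n := by
    simp
  let e : (Fin n → Fin b) ≃ (Fin n → Fin b) := Equiv.arrowCongr (Equiv.refl _) Fin.revPerm
  have hpoints := sum_one_sub_sq hN hu hv e (centreX_rev hS) centreY_rev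
  have hpairs := sum_sum_one_sub_max hN hu hv e (centreX_rev hS) centreY_rev
  rw [integral_localDisc_sq _ (fun i => (hx i).1) (fun i => (hx i).2) (fun i => (hy i).1)
    (fun i => (hy i).2), hcard]
  simp only [symFam_fst hb, symFam_snd hb, Fintype.sum_prod_type, Fintype.sum_bool, if_true,
    Bool.false_eq_true, if_false]
  simp only [add_mul, sum_add_distrib] at hpoints hpairs ⊢
  unfold potential
  simp only [Nat.cast_pow] at hpoints hpairs ⊢
  have hcollect : ∀ M A B : ℝ, M ≠ 0 →
      (2 * M) ^ 2 / 9 - M * ((((3 * M - 1) * (M + 1)) ^ 2 * M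
          - 2 * ((3 * M - 1) * (M + 1)) * (M * (M ^ 2 - 1) / 3) + A) / (8 * M ^ 4))
        + ((M + 1) ^ 2 - 2 * (M + 1) * (M ^ 2 - 1) / (3 * M) + B / (8 * M ^ 2)) =
      19 / 12 - 7 / 72 * M ^ 2 + 1 / M - 1 / (24 * M ^ 2) + (B - A / M) / (8 * M ^ 2) := by
    intro M A B hM
    field_simp
    ring
  rw [← hcollect _ _ _ hN', ← hpoints, ← hpairs]
  ring

theorem stmt1 (b : ℕ) (hb : 2 ≤ b) (n : ℕ) (hn : 1 ≤ n)
    (S : Fin n → Equiv.Perm (Fin b))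
    (hS : ∀ i, S i = 1 ∨ S i = tauP b) :
    (2 * (b : ℝ) ^ n * L2disc (symFam b n S)) ^ 2 =
      (n : ℝ) * ((b : ℝ) ^ 2 / 360 + 1 / 24 - 2 / (45 * (b : ℝ) ^ 2))
        + 11 / 8 + 1 / (b : ℝ) ^ n
        + (1 - 9 * (-1 : ℝ) ^ b) / (144 * (b : ℝ) ^ (2 * n)) := by
  have hb0 : b ≠ 0 := by omega
  have hN : (b : ℝ) ^ n ≠ 0 := pow_ne_zero _ (by exact_mod_cast hb0)
  have hcard : (Fintype.card (Bool × (Fin n → Fin b)) : ℝ) = 2 * (b : ℝ) ^ n := by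
    simp
  have hint : 0 ≤ ∫ x in (0 : ℝ)..1, ∫ y in (0 : ℝ)..1, (localDisc (symFam b n S) x y) ^ 2 :=
    intervalIntegral.integral_nonneg zero_le_one fun x _ =>
      intervalIntegral.integral_nonneg zero_le_one fun y _ => sq_nonneg _
  have hpar : (-1 : ℝ) ^ b = 1 - 2 * (b % 2 : ℕ) := by
    rcases Nat.mod_two_eq_zero_or_one b with h | h
    · rw [h, (Nat.even_iff.2 h).neg_one_pow]
      simp
    · rw [h, (Nat.odd_iff.2 h).neg_one_pow]
      norm_num
  rw [L2disc, hcard, ← mul_assoc, mul_one_div_cancel (mul_ne_zero two_ne_zero hN), one_mul,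
    Real.sq_sqrt hint, integral_localDisc_symFam hb0 S hS, potential_centre hb0 hn S hS, hpar,
    mul_comm 2 n, pow_mul]
  generalize (b : ℝ) ^ 2 / 360 + 1 / 24 - 2 / (45 * (b : ℝ) ^ 2) = κ
  generalize (b : ℝ) ^ n = M at hN
  generalize ((b % 2 : ℕ) : ℝ) = d
  field_simp
  ring

end SymHamm
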